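/- arXiv:2511.09191 — 2 statements merged into one kernel-verified Lean document; each statement's English description precedes it below -/
import Mathlib

section
/- For every fixed x > 0: \lim_{\alpha \to \infty} \alpha \int_0^1 \frac{ x \, e^{-\alpha^2 s^2} }{ 1 - (1-x) e^{-\alpha^2 s^2} } \sqrt{1-s^2} \, ds = \int_0^{\infty} \frac{ x \, e^{-t^2} }{ 1 - (1-x) e^{-t^2} } \, dt, and the limiting integral is finite. -/
open Real Set MeasureTheory Filter

/-- The rescaled semicircle weight `√(1-s²)` on `[0,1]` is asymptotically the constant `1` near
the origin: `α ∫_0^1 g(αs) √(1-s²) ds → ∫_0^∞ g` for every integrable `g`. -/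
theorem tendsto_mul_integral_comp_mul_sqrt_one_sub_sq {g : ℝ → ℝ} (hg : IntegrableOn g (Ioi 0)) :
    Tendsto (fun α : ℝ => α * ∫ s in (0:ℝ)..1, g (α * s) * √(1 - s ^ 2)) atTop
      (nhds (∫ t in Ioi (0 : ℝ), g t)) := by
  have key : Tendsto (fun α : ℝ => ∫ t in Ioi (0 : ℝ), g t * √(1 - (t / α) ^ 2)) atTop
      (nhds (∫ t in Ioi (0 : ℝ), g t)) := by
    refine tendsto_integral_filter_of_dominated_convergence (fun t => ‖g t‖) ?_ ?_ hg.norm ?_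
    · refine Eventually.of_forall fun α => hg.aestronglyMeasurable.mul ?_
      exact Continuous.aestronglyMeasurable (by fun_prop)
    · refine Eventually.of_forall fun α => Eventually.of_forall fun t => ?_
      rw [norm_mul, Real.norm_of_nonneg (sqrt_nonneg _)]
      refine mul_le_of_le_one_right (norm_nonneg _) (sqrt_le_one.mpr ?_)
      linarith [sq_nonneg (t / α)]
    · refine Eventually.of_forall fun t => ?_
      have h : Tendsto (fun α : ℝ => t / α) atTop (nhds 0) :=
        tendsto_const_nhds.div_atTop tendsto_id
      simpa using (((h.pow 2).const_sub 1).sqrt).const_mul (g t)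
  refine key.congr' ?_
  filter_upwards [eventually_gt_atTop 0] with α hα
  have h := integral_comp_mul_left_Ioi' (fun t => g t * √(1 - (t / α) ^ 2)) 0 hα
  rw [mul_zero, smul_eq_mul] at h
  rw [← h, intervalIntegral.integral_of_le zero_le_one]
  simp only [mul_div_cancel_left₀ _ hα.ne']
  congr 1
  refine setIntegral_eq_of_subset_of_forall_sdiff_eq_zero measurableSet_Ioi
    Ioc_subset_Ioi_self fun s hs => ?_
  have hs1 : 1 < s := by
    by_contra! hle
    exact hs.2 ⟨hs.1, hle⟩
  rw [sqrt_eq_zero_of_nonpos (by nlinarith), mul_zero]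

theorem min_one_le_one_sub_mul {x y : ℝ} (hy0 : 0 ≤ y) (hy1 : y ≤ 1) :
    min 1 x ≤ 1 - (1 - x) * y := by
  nlinarith [min_le_left 1 x, min_le_right 1 x]

theorem integrable_mul_exp_neg_sq_div {x : ℝ} (hx : 0 < x) :
    Integrable (fun t : ℝ => x * exp (-t ^ 2) / (1 - (1 - x) * exp (-t ^ 2))) := by
  have hm : 0 < min 1 x := lt_min one_pos hx
  have hden (t : ℝ) : min 1 x ≤ 1 - (1 - x) * exp (-t ^ 2) :=
    min_one_le_one_sub_mul (exp_pos _).le (exp_le_one_iff.mpr (by nlinarith))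
  have hgauss : Integrable (fun t : ℝ => x * exp (-t ^ 2) / min 1 x) := by
    simpa using ((integrable_exp_neg_mul_sq one_pos).const_mul x).div_const (min 1 x)
  refine hgauss.mono' ?_ (Eventually.of_forall fun t => ?_)
  · exact Continuous.aestronglyMeasurable <|
      Continuous.div (by fun_prop) (by fun_prop) fun t => (hm.trans_le (hden t)).ne'
  · have := hm.trans_le (hden t)
    rw [Real.norm_of_nonneg (by positivity)]
    gcongr
    exact hden t

/-- **Strong-asymmetry limit of `Φ_w`.** For every fixed `x > 0`,
`α ∫_0^1 x e^{-α²s²}/(1-(1-x)e^{-α²s²}) √(1-s²) ds → ∫_0^∞ x e^{-t²}/(1-(1-x)e^{-t²}) dt`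
as `α → ∞`, and the limiting integral is finite. -/
theorem alpha_mul_phiW_integral_tendsto (x : ℝ) (hx : 0 < x) :
    Tendsto (fun α : ℝ => α * ∫ s in (0:ℝ)..1,
        (x * Real.exp (-α ^ 2 * s ^ 2) / (1 - (1 - x) * Real.exp (-α ^ 2 * s ^ 2))) *
          Real.sqrt (1 - s ^ 2)) atTop
      (nhds (∫ t in Set.Ioi (0 : ℝ),
        x * Real.exp (-t ^ 2) / (1 - (1 - x) * Real.exp (-t ^ 2)))) ∧
    MeasureTheory.IntegrableOn
      (fun t : ℝ => x * Real.exp (-t ^ 2) / (1 - (1 - x) * Real.exp (-t ^ 2)))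
      (Set.Ioi 0) := by
  have hint := (integrable_mul_exp_neg_sq_div hx).integrableOn (s := Ioi 0)
  refine ⟨?_, hint⟩
  simpa only [mul_pow, neg_mul] using tendsto_mul_integral_comp_mul_sqrt_one_sub_sq hint
end

section
/- For every \tau \in [0,1), the function u \mapsto \Psi_s(e^u;\tau) is strictly convex on \mathbb{R}, and for every \alpha > 0, the function u \mapsto \Psi_w(e^u;\alpha) is strictly convex on \mathbb{R}. Equivalently, z \mapsto z \, \Psi_s'(z;\tau) and z \mapsto z \, \Psi_w'(z;\alpha) are strictly increasing on (0,\infty). -/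
open Real Set MeasureTheory Filter

/-- `Ψ_s(z;τ) = √((1+τ)/((1-τ)·2π)) · (2/√π) ∫_0^∞ log(1 - (1-z) e^{-t²}) dt`. -/
noncomputable def PsiS (τ z : ℝ) : ℝ :=
  Real.sqrt ((1 + τ) / ((1 - τ) * (2 * Real.pi))) *
    ((2 / Real.sqrt Real.pi) *
      ∫ t in Set.Ioi (0 : ℝ), Real.log (1 - (1 - z) * Real.exp (-t ^ 2)))

/-- `φ_s(x;τ) = sup_{u ∈ ℝ} { (x/2) u - Ψ_s(e^u;τ) }`. -/
noncomputable def phiS (τ x : ℝ) : ℝ :=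
  ⨆ u : ℝ, ((x / 2) * u - PsiS τ (Real.exp u))

/-- `Ψ_w(z;α) = (2/π) ∫_0^1 log(1 - (1-z) e^{-α²s²}) √(1-s²) ds`. -/
noncomputable def PsiW (α z : ℝ) : ℝ :=
  (2 / Real.pi) *
    ∫ s in (0:ℝ)..1, Real.log (1 - (1 - z) * Real.exp (-α ^ 2 * s ^ 2)) * Real.sqrt (1 - s ^ 2)

/-- `φ_w(x;α) = sup_{u ∈ ℝ} { (x/2) u - Ψ_w(e^u;α) }`. -/
noncomputable def phiW (α x : ℝ) : ℝ :=
  ⨆ u : ℝ, ((x / 2) * u - PsiW α (Real.exp u))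

/-- `c(α) = (4/π) ∫_0^1 e^{-α²s²} √(1-s²) ds`. -/
noncomputable def cFun (α : ℝ) : ℝ :=
  (4 / Real.pi) * ∫ s in (0:ℝ)..1, Real.exp (-α ^ 2 * s ^ 2) * Real.sqrt (1 - s ^ 2)

section LogIntegral

variable {Ω : Type*} [MeasurableSpace Ω] {μ : Measure Ω} {q w : Ω → ℝ}

lemma min_one_le_one_sub_one_sub_mul {z q : ℝ} (hq0 : 0 ≤ q) (hq1 : q ≤ 1) :
    min 1 z ≤ 1 - (1 - z) * q := by
  rcases le_total 1 z with h | h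
  · rw [min_eq_left h]; nlinarith
  · rw [min_eq_right h]; nlinarith

lemma abs_log_le_abs_sub_one_div {m x : ℝ} (hm : 0 < m) (hm1 : m ≤ 1) (hx : m ≤ x) :
    |log x| ≤ |x - 1| / m := by
  have hx0 : 0 < x := hm.trans_le hx
  have key : |x - 1| ≤ |x - 1| / m := by
    rw [le_div_iff₀ hm]
    nlinarith [abs_nonneg (x - 1)]
  refine abs_le.2 ⟨?_, (log_le_sub_one_of_pos hx0).trans ((le_abs_self _).trans key)⟩
  have h1 := one_sub_inv_le_log_of_pos hx0
  have h2 : 1 - x⁻¹ = (x - 1) / x := by field_simp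
  have h3 : |(x - 1) / x| ≤ |x - 1| / m := by
    rw [abs_div, abs_of_pos hx0]
    gcongr
  linarith [neg_abs_le ((x - 1) / x)]

/-- Differentiation under the integral sign for `z ↦ ∫ log (1 - (1 - z) q) w`. -/
lemma hasDerivAt_integral_log_one_sub (hq : Measurable q) (hw : Measurable w)
    (hq0 : ∀ᵐ t ∂μ, 0 < q t) (hq1 : ∀ᵐ t ∂μ, q t < 1) (hw0 : ∀ᵐ t ∂μ, 0 < w t)
    (hint : Integrable (fun t => q t * w t) μ) {z : ℝ} (hz : 0 < z) :
    Integrable (fun t => q t / (1 - (1 - z) * q t) * w t) μ ∧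
      HasDerivAt (fun z => ∫ t, log (1 - (1 - z) * q t) * w t ∂μ)
        (∫ t, q t / (1 - (1 - z) * q t) * w t ∂μ) z := by
  have hm : 0 < min 1 (z / 2) := lt_min one_pos (half_pos hz)
  have hm1 : min 1 (z / 2) ≤ 1 := min_le_left _ _
  have hlow : ∀ x ∈ Ioi (z / 2), ∀ t, 0 < q t → q t < 1 →
      min 1 (z / 2) ≤ 1 - (1 - x) * q t := fun x hx t h0 h1 =>
    (min_le_min_left 1 (le_of_lt hx)).trans (min_one_le_one_sub_one_sub_mul h0.le h1.le)
  refine hasDerivAt_integral_of_dominated_loc_of_deriv_le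
    (F := fun z t => log (1 - (1 - z) * q t) * w t)
    (F' := fun z t => q t / (1 - (1 - z) * q t) * w t)
    (bound := fun t => q t * w t / min 1 (z / 2))
    (Ioi_mem_nhds (half_lt_self hz)) ?_ ?_ ?_ ?_ (hint.div_const _) ?_
  · exact Eventually.of_forall fun x => by fun_prop
  · refine (hint.const_mul (|z - 1| / min 1 (z / 2))).mono' (by fun_prop) ?_
    filter_upwards [hq0, hq1, hw0] with t h0 h1 h2
    have h := abs_log_le_abs_sub_one_div hm hm1 (hlow z (half_lt_self hz) t h0 h1)
    have he : 1 - (1 - z) * q t - 1 = (z - 1) * q t := by ring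
    rw [he, abs_mul, abs_of_pos h0] at h
    rw [norm_mul, norm_eq_abs, norm_eq_abs, abs_of_pos h2]
    calc |log (1 - (1 - z) * q t)| * w t ≤ |z - 1| * q t / min 1 (z / 2) * w t := by gcongr
      _ = _ := by ring
  · fun_prop
  · filter_upwards [hq0, hq1, hw0] with t h0 h1 h2 x hx
    have hl := hlow x hx t h0 h1
    have hp := hm.trans_le hl
    rw [norm_eq_abs, abs_of_pos (by positivity), mul_div_right_comm]
    gcongr
  · filter_upwards [hq0, hq1] with t h0 h1 x hx
    have hp := hm.trans_le (hlow x hx t h0 h1)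
    have h := ((((hasDerivAt_id x).const_sub 1).mul_const (q t)).const_sub 1).log hp.ne'
    simpa using h.mul_const (w t)

/-- The logarithmic derivative `z ↦ z ∂_z ∫ log (1 - (1 - z) q) w` is strictly increasing. -/
lemma mul_integral_div_one_sub_lt (hμ : μ ≠ 0) (hq : Measurable q) (hw : Measurable w)
    (hq0 : ∀ᵐ t ∂μ, 0 < q t) (hq1 : ∀ᵐ t ∂μ, q t < 1) (hw0 : ∀ᵐ t ∂μ, 0 < w t)
    (hint : Integrable (fun t => q t * w t) μ) {x y : ℝ} (hx : 0 < x) (hxy : x < y) :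
    x * ∫ t, q t / (1 - (1 - x) * q t) * w t ∂μ < y * ∫ t, q t / (1 - (1 - y) * q t) * w t ∂μ := by
  have hy : 0 < y := hx.trans hxy
  have ix := ((hasDerivAt_integral_log_one_sub hq hw hq0 hq1 hw0 hint hx).1).const_mul x
  have iy := ((hasDerivAt_integral_log_one_sub hq hw hq0 hq1 hw0 hint hy).1).const_mul y
  rw [← sub_pos, ← integral_const_mul, ← integral_const_mul, ← integral_sub iy ix]
  have hpos : ∀ᵐ t ∂μ, 0 < y * (q t / (1 - (1 - y) * q t) * w t) -
      x * (q t / (1 - (1 - x) * q t) * w t) := by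
    filter_upwards [hq0, hq1, hw0] with t h0 h1 h2
    have hpx : 0 < 1 - (1 - x) * q t := by nlinarith
    have hpy : 0 < 1 - (1 - y) * q t := by nlinarith
    have he : y * (q t / (1 - (1 - y) * q t) * w t) - x * (q t / (1 - (1 - x) * q t) * w t) =
        q t * w t * (y - x) * (1 - q t) / ((1 - (1 - y) * q t) * (1 - (1 - x) * q t)) := by
      have hnum : (y - x) * (1 - q t) = y * (1 - (1 - x) * q t) - x * (1 - (1 - y) * q t) := by
        ring
      rw [mul_assoc _ (y - x), hnum]
      generalize 1 - (1 - x) * q t = a at hpx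
      generalize 1 - (1 - y) * q t = b at hpy
      field_simp
    rw [he]
    have := sub_pos.2 hxy
    have := sub_pos.2 h1
    positivity
  rw [integral_pos_iff_support_of_nonneg_ae (hpos.mono fun _ h => h.le) (iy.sub ix)]
  refine pos_iff_ne_zero.2 fun h0 => hμ ?_
  have hz : ∀ᵐ t ∂μ, ¬ (y * (q t / (1 - (1 - y) * q t) * w t) -
      x * (q t / (1 - (1 - x) * q t) * w t) ≠ 0) := measure_eq_zero_iff_ae_notMem.1 h0
  rw [← ae_eq_bot, ← Filter.eventually_false_iff_eq_bot]
  filter_upwards [hpos, hz] with t h h'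
  exact h' h.ne'

end LogIntegral

/-- If `z G'(z)` is strictly increasing on `(0,∞)`, then `u ↦ G (exp u)` is strictly convex. -/
lemma strictConvexOn_comp_exp {G : ℝ → ℝ} (hG : ∀ z, 0 < z → DifferentiableAt ℝ G z)
    (hmono : StrictMonoOn (fun z => z * deriv G z) (Ioi 0)) :
    StrictConvexOn ℝ univ fun u => G (exp u) := by
  have hd : ∀ u, HasDerivAt (fun u => G (exp u)) (exp u * deriv G (exp u)) u := fun u => by
    rw [mul_comm]
    exact (hG _ (exp_pos u)).hasDerivAt.comp u (hasDerivAt_exp u)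
  refine StrictMono.strictConvexOn_univ_of_deriv
    (continuous_iff_continuousAt.2 fun u => (hd u).continuousAt) fun u v huv => ?_
  rw [(hd u).deriv, (hd v).deriv]
  exact hmono (exp_pos u) (exp_pos v) (exp_lt_exp.2 huv)

lemma strictConvexOn_and_strictMonoOn_of_eq_integral_log {Ω : Type*} [MeasurableSpace Ω]
    {μ : Measure Ω} {q w : Ω → ℝ} (hμ : μ ≠ 0) (hq : Measurable q) (hw : Measurable w)
    (hq0 : ∀ᵐ t ∂μ, 0 < q t) (hq1 : ∀ᵐ t ∂μ, q t < 1) (hw0 : ∀ᵐ t ∂μ, 0 < w t)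
    (hint : Integrable (fun t => q t * w t) μ) {c : ℝ} (hc : 0 < c) {G : ℝ → ℝ}
    (hG : ∀ z, G z = c * ∫ t, log (1 - (1 - z) * q t) * w t ∂μ) :
    StrictConvexOn ℝ univ (fun u => G (exp u)) ∧
      StrictMonoOn (fun z => z * deriv G z) (Ioi 0) := by
  obtain rfl := funext hG
  have hd : ∀ z, 0 < z → HasDerivAt (fun z => c * ∫ t, log (1 - (1 - z) * q t) * w t ∂μ)
      (c * ∫ t, q t / (1 - (1 - z) * q t) * w t ∂μ) z := fun z hz =>
    (hasDerivAt_integral_log_one_sub hq hw hq0 hq1 hw0 hint hz).2.const_mul c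
  have hmono : StrictMonoOn
      (fun z => z * deriv (fun z => c * ∫ t, log (1 - (1 - z) * q t) * w t ∂μ) z) (Ioi 0) := by
    intro x hx y hy hxy
    simp only [(hd x hx).deriv, (hd y hy).deriv, mul_left_comm _ c]
    exact mul_lt_mul_of_pos_left (mul_integral_div_one_sub_lt hμ hq hw hq0 hq1 hw0 hint hx hxy) hc
  exact ⟨strictConvexOn_comp_exp (fun z hz => (hd z hz).differentiableAt) hmono, hmono⟩

/-- **Strict convexity of `u ↦ Ψ_s(e^u;τ)` and `u ↦ Ψ_w(e^u;α)`.** For every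
`τ ∈ [0,1)` and every `α > 0`, the functions `u ↦ Ψ_s(e^u;τ)` and `u ↦ Ψ_w(e^u;α)` are
strictly convex on `ℝ`; equivalently, `z ↦ z Ψ_s'(z;τ)` and `z ↦ z Ψ_w'(z;α)` are
strictly increasing on `(0,∞)`. -/
theorem psiS_psiW_strictly_convex :
    (∀ τ : ℝ, 0 ≤ τ → τ < 1 →
      StrictConvexOn ℝ Set.univ (fun u : ℝ => PsiS τ (Real.exp u)) ∧
      StrictMonoOn (fun z : ℝ => z * deriv (PsiS τ) z) (Set.Ioi 0)) ∧
    (∀ α : ℝ, 0 < α →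
      StrictConvexOn ℝ Set.univ (fun u : ℝ => PsiW α (Real.exp u)) ∧
      StrictMonoOn (fun z : ℝ => z * deriv (PsiW α) z) (Set.Ioi 0)) := by
  refine ⟨fun τ h0 h1 => ?_, fun α hα => ?_⟩
  · refine strictConvexOn_and_strictMonoOn_of_eq_integral_log
      (μ := volume.restrict (Ioi (0 : ℝ))) (q := fun t => exp (-t ^ 2)) (w := fun _ => 1)
      (c := √((1 + τ) / ((1 - τ) * (2 * π))) * (2 / √π))
      ?_ (by fun_prop) (by fun_prop) ?_ ?_ ?_ ?_ ?_ fun z => ?_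
    · simp
    · exact ae_of_all _ fun t => exp_pos _
    · filter_upwards [ae_restrict_mem measurableSet_Ioi] with t (ht : 0 < t)
      exact exp_lt_one_iff.2 (by nlinarith)
    · exact ae_of_all _ fun t => one_pos
    · simpa [IntegrableOn] using (integrable_exp_neg_mul_sq one_pos).integrableOn (s := Ioi 0)
    · have := sub_pos.2 h1
      positivity
    · simp only [PsiS, mul_one, mul_assoc]
  · refine strictConvexOn_and_strictMonoOn_of_eq_integral_log
      (μ := volume.restrict (Ioo (0 : ℝ) 1)) (q := fun s => exp (-α ^ 2 * s ^ 2))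
      (w := fun s => √(1 - s ^ 2)) (c := 2 / π)
      ?_ (by fun_prop) (by fun_prop) ?_ ?_ ?_ ?_ (by positivity) fun z => ?_
    · simp
    · exact ae_of_all _ fun t => exp_pos _
    · filter_upwards [ae_restrict_mem measurableSet_Ioo] with t ht
      have := ht.1
      have : 0 < α ^ 2 * t ^ 2 := by positivity
      exact exp_lt_one_iff.2 (by linarith)
    · filter_upwards [ae_restrict_mem measurableSet_Ioo] with t ht
      exact sqrt_pos.2 (by nlinarith [ht.1, ht.2])
    · have hc : Continuous fun s : ℝ => exp (-α ^ 2 * s ^ 2) * √(1 - s ^ 2) := by fun_prop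
      exact (hc.integrableOn_Icc (a := 0) (b := 1)).mono_set Ioo_subset_Icc_self
    · rw [PsiW, intervalIntegral.integral_of_le zero_le_one, integral_Ioc_eq_integral_Ioo]
end
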